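/- t is reachable from s by a directed path in G if and only if there is a set D of at most k vertices of G′ such that every vertex of the induced subgraph G′ ∖ D has degree at least 2, that is, has two distinct neighbors in G′ ∖ D. -/

import Mathlib

/-- A directed graph on `Fin n × Fin k` (layer `i+1`, 1-based, is `Fin n × {i}`) is a
*matched layered graph* if every edge goes from a layer to the next one, every vertex
outside the last layer has exactly one out-neighbor, and every vertex outside the
first layer has exactly one in-neighbor. -/
def MatchedLayered {n k : ℕ} (E : Fin n × Fin k → Fin n × Fin k → Prop) : Prop :=
  (∀ v w, E v w → (w.2 : ℕ) = (v.2 : ℕ) + 1) ∧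
    (∀ v, (v.2 : ℕ) + 1 < k → ∃! w, E v w) ∧
    (∀ w, 0 < (w.2 : ℕ) → ∃! v, E v w)

/-- The vertex set of `G′`: the original vertices plus one new vertex (`Sum.inr ()`). -/
def Vert (n k : ℕ) : Type := (Fin n × Fin k) ⊕ Unit

/-- The edges of `G′`: the underlying undirected edges of `G`, plus an edge from the
new vertex to every vertex of `(V₁ ∪ V_k) ∖ {s, t}`. -/
inductive GRel {n k : ℕ} (E : Fin n × Fin k → Fin n × Fin k → Prop) (s t : Fin n × Fin k) :
    Vert n k → Vert n k → Prop
  | base {v w} : E v w → GRel E s t (Sum.inl v) (Sum.inl w)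
  | hub (v : Fin n × Fin k) : ((v.2 : ℕ) = 0 ∨ (v.2 : ℕ) + 1 = k) → v ≠ s → v ≠ t →
      GRel E s t (Sum.inr ()) (Sum.inl v)

section helpers
variable {n k : ℕ} {E : Fin n × Fin k → Fin n × Fin k → Prop} {s t : Fin n × Fin k}

theorem h_adj_inl (hE : MatchedLayered E) (u : Fin n × Fin k) (y : Vert n k) :
    (SimpleGraph.fromRel (GRel E s t)).Adj (Sum.inl u : Vert n k) y ↔
      (∃ w, y = Sum.inl w ∧ E u w) ∨ (∃ w, y = Sum.inl w ∧ E w u) ∨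
      (y = Sum.inr () ∧ ((u.2 : ℕ) = 0 ∨ (u.2 : ℕ) + 1 = k) ∧ u ≠ s ∧ u ≠ t) := by
  refine (SimpleGraph.fromRel_adj _ _ _).trans ?_
  constructor
  · rintro ⟨_, h | h⟩
    · cases h with
      | base h => exact Or.inl ⟨_, rfl, h⟩
    · cases h with
      | base h => exact Or.inr (Or.inl ⟨_, rfl, h⟩)
      | hub _ h1 h2 h3 => exact Or.inr (Or.inr ⟨rfl, h1, h2, h3⟩)
  · rintro (⟨w, rfl, h⟩ | ⟨w, rfl, h⟩ | ⟨rfl, h1, h2, h3⟩)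
    · refine ⟨?_, Or.inl (GRel.base h)⟩
      intro e
      have := hE.1 _ _ h
      have e' := Sum.inl.inj e
      subst e'
      omega
    · refine ⟨?_, Or.inr (GRel.base h)⟩
      intro e
      have := hE.1 _ _ h
      have e' := Sum.inl.inj e
      subst e'
      omega
    · exact ⟨fun e => Sum.inl_ne_inr e, Or.inr (GRel.hub u h1 h2 h3)⟩

theorem h_out (hE : MatchedLayered E) {u v w : Fin n × Fin k} (h1 : E u v) (h2 : E u w) :
    v = w := by
  have := hE.1 _ _ h1
  have := v.2.2
  exact (hE.2.1 u (by omega)).unique h1 h2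

theorem h_in (hE : MatchedLayered E) {u v w : Fin n × Fin k} (h1 : E u w) (h2 : E v w) :
    u = v := by
  have := hE.1 _ _ h1
  exact (hE.2.2 w (by omega)).unique h1 h2

theorem h_reach_unique (hE : MatchedLayered E) (hs : (s.2 : ℕ) = 0) {v : Fin n × Fin k}
    (h : Relation.ReflTransGen E s v) :
    ∀ u, Relation.ReflTransGen E s u → (u.2 : ℕ) = v.2 → u = v := by
  induction h with
  | refl =>
    intro u hu e
    rcases Relation.ReflTransGen.cases_tail hu with h | ⟨c, _, h⟩
    · exact h
    · have := hE.1 _ _ h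
      omega
  | tail hb hbv ih =>
    intro u hu e
    have h0 := hE.1 _ _ hbv
    rcases Relation.ReflTransGen.cases_tail hu with h | ⟨c, hc, h⟩
    · subst h; omega
    · have := hE.1 _ _ h
      have e2 := ih c hc (by omega)
      subst e2
      exact h_out hE h hbv

theorem h_layer_fwd (hE : MatchedLayered E) (hs : (s.2 : ℕ) = 0) (i : ℕ) (hi : i < k) :
    ∃ v, Relation.ReflTransGen E s v ∧ (v.2 : ℕ) = i := by
  induction i with
  | zero => exact ⟨s, .refl, hs⟩
  | succ i ih =>
    obtain ⟨v, hv, e⟩ := ih (by omega)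
    obtain ⟨w, hw, _⟩ := hE.2.1 v (by omega)
    exact ⟨w, hv.tail hw, by rw [hE.1 _ _ hw, e]⟩

theorem h_layer_bwd (hE : MatchedLayered E) (ht : (t.2 : ℕ) + 1 = k) (i : ℕ) (hi : i < k) :
    ∃ v, Relation.ReflTransGen E v t ∧ (v.2 : ℕ) + 1 + i = k := by
  induction i with
  | zero => exact ⟨t, .refl, ht⟩
  | succ i ih =>
    obtain ⟨v, hv, e⟩ := ih (by omega)
    obtain ⟨w, hw, _⟩ := hE.2.2 v (by omega)
    have := hE.1 _ _ hw
    exact ⟨w, hv.head hw, by omega⟩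

end helpers

/-- `t` is reachable from `s` in the matched layered graph `G` if and
only if at most `k` vertices can be deleted from `G′` so that in the remaining induced
subgraph every vertex has two distinct neighbors. -/
theorem stmt_10 {n k : ℕ} (hn : 2 ≤ n) (hk : 2 ≤ k)
    (E : Fin n × Fin k → Fin n × Fin k → Prop)
    (hE : MatchedLayered E) (s t : Fin n × Fin k)
    (hs : (s.2 : ℕ) = 0) (ht : (t.2 : ℕ) + 1 = k) :
    Relation.ReflTransGen E s t ↔
      ∃ D : Set (Vert n k), D.ncard ≤ k ∧
        ∀ x : ↥(Dᶜ), ∃ y z : ↥(Dᶜ), y ≠ z ∧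
          ((SimpleGraph.fromRel (GRel E s t)).induce Dᶜ).Adj x y ∧
          ((SimpleGraph.fromRel (GRel E s t)).induce Dᶜ).Adj x z := by
  have hfin : Finite (Vert n k) := inferInstanceAs (Finite ((Fin n × Fin k) ⊕ Unit))
  constructor
  · intro hst
    let A : Set (Fin n × Fin k) := {v | Relation.ReflTransGen E s v}
    let D : Set (Vert n k) := (fun v => (Sum.inl v : Vert n k)) '' A
    have hD : ∀ v, (Sum.inl v : Vert n k) ∈ D ↔ Relation.ReflTransGen E s v := by
      intro v
      constructor
      · rintro ⟨w, hw, e⟩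
        have := Sum.inl.inj e
        subst this
        exact hw
      · intro h
        exact ⟨v, h, rfl⟩
    have hDr : (Sum.inr () : Vert n k) ∉ D := by
      rintro ⟨w, hw, e⟩
      exact Sum.inl_ne_inr e
    refine ⟨D, ?_, ?_⟩
    · refine (Set.ncard_image_le (Set.toFinite A)).trans ?_
      have : A.ncard ≤ (Set.univ : Set (Fin k)).ncard := by
        apply Set.ncard_le_ncard_of_injOn (fun v => v.2) (fun _ _ => Set.mem_univ _) ?_
          (Set.toFinite _)
        intro u hu v hv e
        exact h_reach_unique hE hs hv u hu (congrArg Fin.val e)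
      simpa [Set.ncard_univ] using this
    · rintro ⟨x, hx⟩
      suffices h : ∃ y z : Vert n k, y ∉ D ∧ z ∉ D ∧ y ≠ z ∧
          (SimpleGraph.fromRel (GRel E s t)).Adj x y ∧
          (SimpleGraph.fromRel (GRel E s t)).Adj x z by
        obtain ⟨y, z, hy, hz, hyz, h1, h2⟩ := h
        exact ⟨⟨y, hy⟩, ⟨z, hz⟩, fun e => hyz (congrArg Subtype.val e), h1, h2⟩
      rcases x with v | ⟨⟩
      · have hv : ¬ Relation.ReflTransGen E s v := fun h => hx ((hD v).2 h)
        have hvs : v ≠ s := by rintro rfl; exact hv .refl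
        have hvt : v ≠ t := by rintro rfl; exact hv hst
        have hnext : v.2.val + 1 < k → ∃ w, E v w ∧ (Sum.inl w : Vert n k) ∉ D := by
          intro h
          obtain ⟨w, hw, _⟩ := hE.2.1 v h
          refine ⟨w, hw, fun h' => ?_⟩
          rw [hD] at h'
          rcases Relation.ReflTransGen.cases_tail h' with e | ⟨c, hc, h''⟩
          · have := hE.1 _ _ hw
            subst e
            omega
          · rw [h_in hE h'' hw] at hc
            exact hv hc
        have hprev : 0 < v.2.val → ∃ w, E w v ∧ (Sum.inl w : Vert n k) ∉ D := by
          intro h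
          obtain ⟨w, hw, _⟩ := hE.2.2 v h
          refine ⟨w, hw, fun h' => ?_⟩
          rw [hD] at h'
          exact hv (h'.tail hw)
        have hlt := v.2.2
        by_cases c1 : v.2.val + 1 < k
        · obtain ⟨w, hw, hwD⟩ := hnext c1
          by_cases c2 : 0 < v.2.val
          · obtain ⟨w', hw', hwD'⟩ := hprev c2
            refine ⟨Sum.inl w, Sum.inl w', hwD, hwD', ?_, ?_, ?_⟩
            · intro e
              have e' := Sum.inl.inj e
              have := hE.1 _ _ hw
              have := hE.1 _ _ hw'
              subst e'
              omega
            · exact (h_adj_inl hE _ _).2 (Or.inl ⟨w, rfl, hw⟩)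
            · exact (h_adj_inl hE _ _).2 (Or.inr (Or.inl ⟨w', rfl, hw'⟩))
          · refine ⟨Sum.inl w, Sum.inr (), hwD, hDr, fun e => Sum.inl_ne_inr e, ?_, ?_⟩
            · exact (h_adj_inl hE _ _).2 (Or.inl ⟨w, rfl, hw⟩)
            · exact (h_adj_inl hE _ _).2 (Or.inr (Or.inr ⟨rfl, by omega, hvs, hvt⟩))
        · obtain ⟨w', hw', hwD'⟩ := hprev (by omega)
          refine ⟨Sum.inl w', Sum.inr (), hwD', hDr, fun e => Sum.inl_ne_inr e, ?_, ?_⟩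
          · exact (h_adj_inl hE _ _).2 (Or.inr (Or.inl ⟨w', rfl, hw'⟩))
          · exact (h_adj_inl hE _ _).2 (Or.inr (Or.inr ⟨rfl, by omega, hvs, hvt⟩))
      · have : Nontrivial (Fin n) := Fin.nontrivial_iff_two_le.2 hn
        obtain ⟨a, ha⟩ := exists_ne s.1
        obtain ⟨b, hb⟩ := exists_ne t.1
        have hne : s.2 ≠ t.2 := by intro e; rw [e] at hs; omega
        refine ⟨Sum.inl (a, s.2), Sum.inl (b, t.2), ?_, ?_, ?_, ?_, ?_⟩
        · intro h
          replace h := (hD _).1 h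
          exact ha (congrArg Prod.fst (h_reach_unique hE hs .refl _ h rfl))
        · intro h
          replace h := (hD _).1 h
          exact hb (congrArg Prod.fst (h_reach_unique hE hs hst _ h rfl))
        · intro e
          have e' := Sum.inl.inj e
          exact hne (Prod.ext_iff.1 e').2
        · refine SimpleGraph.Adj.symm ((h_adj_inl hE _ _).2 (Or.inr (Or.inr ⟨rfl, Or.inl hs, ?_, ?_⟩)))
          · intro e; exact ha (congrArg Prod.fst e)
          · intro e; exact hne (Prod.ext_iff.1 e).2
        · refine SimpleGraph.Adj.symm ((h_adj_inl hE _ _).2 (Or.inr (Or.inr ⟨rfl, Or.inr ht, ?_, ?_⟩)))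
          · intro e; exact hne (Prod.ext_iff.1 e).2.symm
          · intro e; exact hb (congrArg Prod.fst e)
  · rintro ⟨D, hcard, hdeg⟩
    by_contra hst
    have hdeg' : ∀ u, (Sum.inl u : Vert n k) ∉ D → ∃ y z : Vert n k, y ∉ D ∧ z ∉ D ∧ y ≠ z ∧
          (SimpleGraph.fromRel (GRel E s t)).Adj (Sum.inl u : Vert n k) y ∧
          (SimpleGraph.fromRel (GRel E s t)).Adj (Sum.inl u : Vert n k) z := by
      intro u hu
      obtain ⟨y, z, hyz, h1, h2⟩ := hdeg ⟨_, hu⟩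
      exact ⟨y, z, y.2, z.2, fun e => hyz (Subtype.ext e), h1, h2⟩
    have hsD : (Sum.inl s : Vert n k) ∈ D := by
      by_contra hu
      obtain ⟨y, z, hy, hz, hyz, h1, h2⟩ := hdeg' s hu
      rw [h_adj_inl hE] at h1 h2
      rcases h1 with ⟨a, rfl, ha⟩ | ⟨a, rfl, ha⟩ | ⟨_, _, h, _⟩
      · rcases h2 with ⟨b, rfl, hb⟩ | ⟨b, rfl, hb⟩ | ⟨_, _, h, _⟩
        · rw [h_out hE ha hb] at hyz
          exact hyz rfl
        · have := hE.1 _ _ hb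
          omega
        · exact h rfl
      · have := hE.1 _ _ ha
        omega
      · exact h rfl
    have htD : (Sum.inl t : Vert n k) ∈ D := by
      by_contra hu
      obtain ⟨y, z, hy, hz, hyz, h1, h2⟩ := hdeg' t hu
      rw [h_adj_inl hE] at h1 h2
      rcases h1 with ⟨a, rfl, ha⟩ | ⟨a, rfl, ha⟩ | ⟨_, _, _, h⟩
      · have := hE.1 _ _ ha
        have := a.2.2
        omega
      · rcases h2 with ⟨b, rfl, hb⟩ | ⟨b, rfl, hb⟩ | ⟨_, _, _, h⟩
        · have := hE.1 _ _ hb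
          have := b.2.2
          omega
        · rw [h_in hE ha hb] at hyz
          exact hyz rfl
        · exact h rfl
      · exact h rfl
    have hf : ∀ v u, E v u → (Sum.inl v : Vert n k) ∈ D → (Sum.inl u : Vert n k) ∈ D := by
      intro v u hvu hv
      by_contra hu
      obtain ⟨y, z, hy, hz, hyz, h1, h2⟩ := hdeg' u hu
      have hl := hE.1 _ _ hvu
      rw [h_adj_inl hE] at h1 h2
      rcases h1 with ⟨a, rfl, ha⟩ | ⟨a, rfl, ha⟩ | ⟨rfl, h, _⟩
      · have := hE.1 _ _ ha
        have := a.2.2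
        rcases h2 with ⟨b, rfl, hb⟩ | ⟨b, rfl, hb⟩ | ⟨rfl, h', _⟩
        · rw [h_out hE ha hb] at hyz
          exact hyz rfl
        · rw [h_in hE hb hvu] at hz
          exact hz hv
        · omega
      · rw [h_in hE ha hvu] at hy
        exact hy hv
      · rcases h2 with ⟨b, rfl, hb⟩ | ⟨b, rfl, hb⟩ | ⟨rfl, h', _⟩
        · have := hE.1 _ _ hb
          have := b.2.2
          omega
        · rw [h_in hE hb hvu] at hz
          exact hz hv
        · exact hyz rfl
    have hb : ∀ u v, E u v → (Sum.inl v : Vert n k) ∈ D → (Sum.inl u : Vert n k) ∈ D := by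
      intro u v hvu hv
      by_contra hu
      obtain ⟨y, z, hy, hz, hyz, h1, h2⟩ := hdeg' u hu
      have hl := hE.1 _ _ hvu
      have := v.2.2
      rw [h_adj_inl hE] at h1 h2
      rcases h1 with ⟨a, rfl, ha⟩ | ⟨a, rfl, ha⟩ | ⟨rfl, h, _⟩
      · rw [h_out hE ha hvu] at hy
        exact hy hv
      · have := hE.1 _ _ ha
        rcases h2 with ⟨b, rfl, hb⟩ | ⟨b, rfl, hb⟩ | ⟨rfl, h', _⟩
        · rw [h_out hE hb hvu] at hz
          exact hz hv
        · rw [h_in hE ha hb] at hyz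
          exact hyz rfl
        · omega
      · rcases h2 with ⟨b, rfl, hb⟩ | ⟨b, rfl, hb⟩ | ⟨rfl, h', _⟩
        · rw [h_out hE hb hvu] at hz
          exact hz hv
        · have := hE.1 _ _ hb
          omega
        · exact hyz rfl
    have hA : ∀ v, Relation.ReflTransGen E s v → (Sum.inl v : Vert n k) ∈ D := by
      intro v h
      induction h with
      | refl => exact hsD
      | tail _ h ih => exact hf _ _ h ih
    have hB : ∀ v, Relation.ReflTransGen E v t → (Sum.inl v : Vert n k) ∈ D := by
      intro v h
      induction h using Relation.ReflTransGen.head_induction_on with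
      | refl => exact htD
      | head h _ ih => exact hb _ _ h ih
    choose a ha1 ha2 using fun i : Fin k => h_layer_fwd hE hs i.1 i.2
    choose b hb1 hb2 using fun i : Fin k => h_layer_bwd hE ht i.1 i.2
    let f : Fin k ⊕ Fin k → D := Sum.elim (fun i => ⟨Sum.inl (a i), hA _ (ha1 i)⟩)
      (fun i => ⟨Sum.inl (b i), hB _ (hb1 i)⟩)
    have hinj : Function.Injective f := by
      rintro (i | i) (j | j) e
      · have e' : a i = a j := Sum.inl.inj (congrArg Subtype.val e)
        have h1 := ha2 i
        rw [e', ha2 j] at h1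
        exact congrArg _ (Fin.ext h1.symm)
      · have e' : a i = b j := Sum.inl.inj (congrArg Subtype.val e)
        have h1 := ha1 i
        rw [e'] at h1
        exact absurd (h1.trans (hb1 j)) hst
      · have e' : b i = a j := Sum.inl.inj (congrArg Subtype.val e)
        have h1 := ha1 j
        rw [← e'] at h1
        exact absurd (h1.trans (hb1 i)) hst
      · have e' : b i = b j := Sum.inl.inj (congrArg Subtype.val e)
        have h1 := hb2 i
        have h2 := hb2 j
        rw [e'] at h1
        exact congrArg _ (Fin.ext (by omega))
    have := Nat.card_le_card_of_injective f hinj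
    rw [Nat.card_coe_set_eq] at this
    simp at this
    omega
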